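/- Let B be an affine algebra over ℝ, let I be an ideal of B, and let f ∈ B be such that f > 0 on X(ℝ), where X = Spec B. Let P be a finitely generated projective B_f-module and let (a, p) ∈ Um(B_f ⊕ P) be such that a ≡ 1 (mod I·B_f) and O(p) + I·B_f = B_f. Then there exist h ∈ 1 + Bf and an automorphism Δ of B_{fh} ⊕ (P ⊗_{B_f} B_{fh}) such that (a, p)Δ = (ã, p) with ã > 0 on X(ℝ) ∩ Spec B_{fh} and ã ≡ 1 (mod I·B_{fh}). -/

import Mathlib

/-- An element `m` of an `R`-module `M` is *unimodular* if some linear functional maps it to `1`. -/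
def IsUnimodular (R : Type*) {M : Type*} [CommRing R] [AddCommGroup M] [Module R M]
    (m : M) : Prop :=
  ∃ ψ : M →ₗ[R] R, ψ m = 1

/-- `O(q)`: the ideal of `B` generated by `ψ(q)`, `ψ ∈ Q*`. -/
def orderIdeal (B : Type*) {Q : Type*} [CommRing B] [AddCommGroup Q] [Module B Q]
    (q : Q) : Ideal B :=
  Ideal.span {x : B | ∃ ψ : Q →ₗ[B] B, ψ q = x}


theorem aux_reduce {k : Type*} [CommRing k] {n D : ℕ}
    (q : Fin n → MvPolynomial (Fin n) k) (hq : ∀ i, (q i).totalDegree ≤ D)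
    (J : Ideal (MvPolynomial (Fin n) k))
    (hJ : ∀ i, MvPolynomial.X i ^ (D + 1) - q i ∈ J) (d : ℕ) :
    ∀ P : MvPolynomial (Fin n) k, P.totalDegree ≤ d →
      P ∈ MvPolynomial.restrictTotalDegree (Fin n) k (n * D) ⊔ J.restrictScalars k := by
  induction d using Nat.strong_induction_on with
  | _ d ih =>
  intro P hP
  rw [P.as_sum]
  refine Submodule.sum_mem _ fun α hα => ?_
  have hαd : (α.sum fun _ e => e) ≤ d := (MvPolynomial.le_totalDegree hα).trans hP
  by_cases hs : ∃ i, D + 1 ≤ α i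
  · obtain ⟨i, hi⟩ := hs
    set β : Fin n →₀ ℕ := α - Finsupp.single i (D + 1) with hβ
    have hαβ : α = β + Finsupp.single i (D + 1) := by
      rw [hβ, tsub_add_cancel_of_le]
      exact Finsupp.single_le_iff.2 hi
    have hsum : (α.sum fun _ e => e) = (β.sum fun _ e => e) + (D + 1) := by
      rw [hαβ, Finsupp.sum_add_index' (by simp) (by simp), Finsupp.sum_single_index rfl]
    have e1 : MvPolynomial.monomial α (P.coeff α) =
        MvPolynomial.monomial β (P.coeff α) * q i +
          MvPolynomial.monomial β (P.coeff α) * (MvPolynomial.X i ^ (D + 1) - q i) := by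
      rw [mul_sub, add_sub_cancel, MvPolynomial.X_pow_eq_monomial, MvPolynomial.monomial_mul,
        ← hαβ, mul_one]
    rw [e1]
    refine Submodule.add_mem _ ?_ ?_
    · refine ih ((β.sum fun _ e => e) + D) (by omega) _ ?_
      refine (MvPolynomial.totalDegree_mul _ _).trans ?_
      exact add_le_add (MvPolynomial.totalDegree_monomial_le _ _) (hq i)
    · refine Submodule.mem_sup_right ?_
      exact J.mul_mem_left _ (hJ i)
  · push Not at hs
    refine Submodule.mem_sup_left ?_
    rw [MvPolynomial.mem_restrictTotalDegree]
    refine (MvPolynomial.totalDegree_monomial_le _ _).trans ?_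
    rw [Finsupp.sum_fintype _ _ (by simp)]
    calc ∑ i, α i ≤ ∑ i : Fin n, D := Finset.sum_le_sum fun i _ => by have := hs i; omega
      _ = n * D := by simp

theorem aux_finite {k : Type*} [CommRing k] {n D : ℕ}
    (q : Fin n → MvPolynomial (Fin n) k) (hq : ∀ i, (q i).totalDegree ≤ D)
    (J : Ideal (MvPolynomial (Fin n) k))
    (hJ : ∀ i, MvPolynomial.X i ^ (D + 1) - q i ∈ J) :
    Module.Finite k (MvPolynomial (Fin n) k ⧸ J) := by
  let g : MvPolynomial.restrictTotalDegree (Fin n) k (n * D) →ₗ[k] (MvPolynomial (Fin n) k ⧸ J) :=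
    (Ideal.Quotient.mkₐ k J).toLinearMap ∘ₗ Submodule.subtype _
  refine Module.Finite.of_surjective g ?_
  intro y
  obtain ⟨P, rfl⟩ := Ideal.Quotient.mk_surjective y
  obtain ⟨u, hu, v, hv, rfl⟩ := Submodule.mem_sup.1 (aux_reduce q hq J hJ _ P le_rfl)
  refine ⟨⟨u, hu⟩, ?_⟩
  have : Ideal.Quotient.mk J v = 0 := Ideal.Quotient.eq_zero_iff_mem.2 hv
  simp [g, this]

theorem aux_integral {k : Type*} [CommRing k] {n D : ℕ}
    (q : Fin n → MvPolynomial (Fin n) k) (hq : ∀ i, (q i).totalDegree ≤ D)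
    (G : MvPolynomial (Fin n) k) :
    ∃ χ : Polynomial k, χ.Monic ∧ ∀ (e : k →+* ℝ) (x : Fin n → ℝ),
      (∀ i, x i ^ (D + 1) = MvPolynomial.eval₂ e x (q i)) →
        χ.eval₂ e (MvPolynomial.eval₂ e x G) = 0 := by
  let J : Ideal (MvPolynomial (Fin n) k) :=
    Ideal.span (Set.range fun i => MvPolynomial.X i ^ (D + 1) - q i)
  have := aux_finite q hq J fun i => Ideal.subset_span ⟨i, rfl⟩
  obtain ⟨χ, hχ, h0⟩ := Algebra.IsIntegral.isIntegral (R := k) (Ideal.Quotient.mk J G)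
  refine ⟨χ, hχ, fun e x hx => ?_⟩
  have hJ : J ≤ RingHom.ker (MvPolynomial.eval₂Hom e x) := by
    rw [Ideal.span_le]
    rintro _ ⟨i, rfl⟩
    simp [hx i]
  let E : (MvPolynomial (Fin n) k ⧸ J) →+* ℝ := Ideal.Quotient.lift J (MvPolynomial.eval₂Hom e x) hJ
  have h1 := congrArg E h0
  rw [Polynomial.hom_eval₂, map_zero] at h1
  have e2 : E.comp (algebraMap k (MvPolynomial (Fin n) k ⧸ J)) = e := by
    ext r
    change E (Ideal.Quotient.mk J (MvPolynomial.C r)) = _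
    exact (Ideal.Quotient.lift_mk J _ hJ).trans (by simp)
  rw [e2] at h1
  have e3 : E (Ideal.Quotient.mk J G) = MvPolynomial.eval₂ e x G := Ideal.Quotient.lift_mk J _ hJ
  rwa [e3] at h1

theorem aux_deriv {n : ℕ} (G : MvPolynomial (Fin n) ℝ) (x : Fin n → ℝ) (i : Fin n) (t : ℝ) :
    HasDerivAt (fun t => MvPolynomial.eval (Function.update x i t) G)
      (MvPolynomial.eval (Function.update x i t) (MvPolynomial.pderiv i G)) t := by
  induction G using MvPolynomial.induction_on with
  | C a => simpa using hasDerivAt_const t a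
  | add p q hp hq =>
    simp only [map_add]
    exact hp.add hq
  | mul_X p j hp =>
    simp only [map_mul, MvPolynomial.eval_X, Derivation.leibniz, smul_eq_mul, map_add]
    by_cases h : j = i
    · subst h
      have hX : HasDerivAt (fun t => Function.update x j t j) 1 t := by
        simp only [Function.update_self]
        exact hasDerivAt_id t
      refine (hp.mul hX).congr_deriv ?_
      simp only [MvPolynomial.pderiv_X_self, map_one]
      ring
    · have hX : HasDerivAt (fun t => Function.update x i t j) 0 t := by
        simp only [Function.update_of_ne h]
        exact hasDerivAt_const t (x j)
      refine (hp.mul hX).congr_deriv ?_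
      rw [MvPolynomial.pderiv_X_of_ne h]
      simp only [map_zero]
      ring

theorem aux_swap (χ : Polynomial (Polynomial (Polynomial ℝ))) (ρ e v : ℝ) :
    (Polynomial.Bivariate.swap χ).eval₂ (Polynomial.eval₂RingHom (Polynomial.evalRingHom ρ) v) e =
    χ.eval₂ (Polynomial.eval₂RingHom (Polynomial.evalRingHom ρ) e) v := by
  have : (Polynomial.eval₂RingHom (Polynomial.eval₂RingHom (Polynomial.evalRingHom ρ) v) e).comp
      (Polynomial.Bivariate.swap (R := Polynomial ℝ)).toRingEquiv.toRingHom =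
      Polynomial.eval₂RingHom (Polynomial.eval₂RingHom (Polynomial.evalRingHom ρ) e) v := by
    ext <;> simp [Polynomial.Bivariate.swap_apply]
  exact congrArg (fun g => g χ) this

/-- leading coefficient limit -/
theorem aux_limit (w : Polynomial (Polynomial ℝ)) (K : ℕ) (hK : w.natDegree ≤ K) (v : ℝ → ℝ) (m : ℝ)
    (hv : Filter.Tendsto v Filter.atTop (nhds m))
    (h : ∀ e > 0, w.eval₂ (Polynomial.evalRingHom (v e)) e = 0) :
    (w.coeff K).eval m = 0 := by
  have h1 : Filter.Tendsto (fun e : ℝ => ∑ k ∈ Finset.range (K + 1),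
      (w.coeff k).eval (v e) * (e⁻¹) ^ (K - k)) Filter.atTop
      (nhds (∑ k ∈ Finset.range (K + 1), (w.coeff k).eval m * 0 ^ (K - k))) := by
    refine tendsto_finsetSum _ fun k _ => ?_
    exact (((w.coeff k).continuous.tendsto m).comp hv).mul (tendsto_inv_atTop_zero.pow _)
  have h2 : (fun e : ℝ => ∑ k ∈ Finset.range (K + 1),
      (w.coeff k).eval (v e) * (e⁻¹) ^ (K - k)) =ᶠ[Filter.atTop] fun _ => 0 := by
    filter_upwards [Filter.eventually_gt_atTop 0] with e he
    have := h e he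
    rw [Polynomial.eval₂_eq_sum_range' _ (Nat.lt_succ_of_le hK)] at this
    have h3 : (∑ k ∈ Finset.range (K + 1), (w.coeff k).eval (v e) * (e⁻¹) ^ (K - k)) =
        (e⁻¹) ^ K * ∑ k ∈ Finset.range (K + 1), (w.coeff k).eval (v e) * e ^ k := by
      rw [Finset.mul_sum]
      refine Finset.sum_congr rfl fun k hk => ?_
      have hk' : k ≤ K := by simpa [Nat.lt_succ_iff] using hk
      have : (e⁻¹) ^ K = (e⁻¹) ^ (K - k) * (e⁻¹) ^ k := by rw [← pow_add]; congr 1; omega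
      rw [this]
      have h5 : (e⁻¹) ^ k * e ^ k = 1 := by rw [← mul_pow, inv_mul_cancel₀ he.ne', one_pow]
      linear_combination (-(w.coeff k).eval (v e) * (e⁻¹) ^ (K - k)) * h5
    rw [h3]
    simp only [Polynomial.coe_evalRingHom] at this
    rw [this, mul_zero]
  have h4 := tendsto_nhds_unique (h1.congr' h2) tendsto_const_nhds
  rw [Finset.sum_range_succ, Finset.sum_eq_zero] at h4
  · simpa using h4
  · intro k hk
    have : K - k ≠ 0 := by have := Finset.mem_range.1 hk; omega
    simp [this]

/-- critical equation for minimum over the box -/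
theorem aux_crit {n : ℕ} (H : MvPolynomial (Fin n) ℝ) (R : ℝ) (x : Fin n → ℝ)
    (hx : ∀ i, |x i| ≤ R)
    (hmin : ∀ y : Fin n → ℝ, (∀ i, |y i| ≤ R) → MvPolynomial.eval x H ≤ MvPolynomial.eval y H)
    (i : Fin n) : (x i ^ 2 - R ^ 2) * MvPolynomial.eval x (MvPolynomial.pderiv i H) = 0 := by
  rcases (hx i).lt_or_eq with h | h
  · have hd := aux_deriv H x i (x i)
    rw [Function.update_eq_self] at hd
    have hloc : IsLocalMin (fun t => MvPolynomial.eval (Function.update x i t) H) (x i) := by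
      have : ∀ᶠ t in nhds (x i), |t| < R :=
        (continuous_abs.tendsto (x i)).eventually (eventually_lt_nhds h)
      filter_upwards [this] with t ht
      rw [Function.update_eq_self]
      refine hmin _ fun j => ?_
      by_cases hj : j = i
      · subst hj; simpa using ht.le
      · simpa [hj] using hx j
    rw [hloc.hasDerivAt_eq_zero hd, mul_zero]
  · rw [← h, sq_abs, sub_self, zero_mul]

theorem aux_min {n : ℕ} (H : MvPolynomial (Fin n) ℝ) (R : ℝ) (hR : 0 ≤ R) :
    ∃ x : Fin n → ℝ, (∀ i, |x i| ≤ R) ∧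
      ∀ y : Fin n → ℝ, (∀ i, |y i| ≤ R) → MvPolynomial.eval x H ≤ MvPolynomial.eval y H := by
  have hc : IsCompact (Set.pi Set.univ fun _ : Fin n => Set.Icc (-R) R) :=
    isCompact_univ_pi fun _ => isCompact_Icc
  have hcont : Continuous fun x : Fin n → ℝ => MvPolynomial.eval x H :=
    MvPolynomial.continuous_eval H
  obtain ⟨x, hx, hmin⟩ := hc.exists_isMinOn ⟨0, fun i _ => by simp [hR]⟩ hcont.continuousOn
  refine ⟨x, fun i => abs_le.2 (hx i trivial), fun y hy => ?_⟩
  exact hmin (show y ∈ _ from fun i _ => abs_le.1 (hy i))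

theorem aux_degree {k : Type*} [CommRing k] [Nontrivial k] {n : ℕ} (ι : ℝ →+* k) (ρ E : k)
    (i : Fin n) (D : ℕ) (Q : MvPolynomial (Fin n) ℝ) (hDi : 2 + Q.totalDegree ≤ D) :
    (MvPolynomial.C (ρ ^ 2) * MvPolynomial.X i ^ (D - 1) -
      (MvPolynomial.X i ^ 2 - MvPolynomial.C (ρ ^ 2)) *
        (MvPolynomial.C E * MvPolynomial.map ι Q)).totalDegree ≤ D := by
  have hm : (MvPolynomial.map ι Q).totalDegree ≤
      Q.totalDegree :=
    Finset.sup_mono (MvPolynomial.support_map_subset _ _)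
  refine (MvPolynomial.totalDegree_sub _ _).trans (max_le ?_ ?_)
  · refine (MvPolynomial.totalDegree_mul _ _).trans ?_
    rw [MvPolynomial.totalDegree_C, MvPolynomial.totalDegree_X_pow]
    omega
  · refine (MvPolynomial.totalDegree_mul _ _).trans ((add_le_add ?_ ?_).trans (hDi))
    · refine (MvPolynomial.totalDegree_sub _ _).trans (max_le ?_ ?_)
      · rw [MvPolynomial.totalDegree_X_pow]
      · rw [MvPolynomial.totalDegree_C]; omega
    · refine (MvPolynomial.totalDegree_mul _ _).trans ?_
      rw [MvPolynomial.totalDegree_C]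
      omega

/-- algebraic relation satisfied by the minimum over boxes -/
theorem aux_relation {n : ℕ} (G : MvPolynomial (Fin n) ℝ) :
    ∃ F : Polynomial (Polynomial ℝ), F ≠ 0 ∧ ∀ R : ℝ, 0 ≤ R → ∀ y : Fin n → ℝ,
      (∀ i, |y i| ≤ R) →
      (∀ z : Fin n → ℝ, (∀ i, |z i| ≤ R) → MvPolynomial.eval y G ≤ MvPolynomial.eval z G) →
      F.eval₂ (Polynomial.evalRingHom R) (MvPolynomial.eval y G) = 0 := by
  classical
  set D : ℕ := 2 + ∑ i, (MvPolynomial.pderiv i G).totalDegree with hD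
  have hDi : ∀ i, 2 + (MvPolynomial.pderiv i G).totalDegree ≤ D := fun i => by
    have := Finset.single_le_sum (f := fun i => (MvPolynomial.pderiv i G).totalDegree)
      (fun _ _ => Nat.zero_le _) (Finset.mem_univ i)
    omega
  let ι : ℝ →+* Polynomial (Polynomial ℝ) := Polynomial.C.comp Polynomial.C
  let ρ : Polynomial (Polynomial ℝ) := Polynomial.C Polynomial.X
  let E : Polynomial (Polynomial ℝ) := Polynomial.X
  let q : Fin n → MvPolynomial (Fin n) (Polynomial (Polynomial ℝ)) := fun i =>
    MvPolynomial.C (ρ ^ 2) * MvPolynomial.X i ^ (D - 1) -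
      (MvPolynomial.X i ^ 2 - MvPolynomial.C (ρ ^ 2)) *
        (MvPolynomial.C E * MvPolynomial.map ι (MvPolynomial.pderiv i G))
  have hq : ∀ i, (q i).totalDegree ≤ D := by
    intro i
    exact aux_degree ι ρ E i D _ (hDi i)
  obtain ⟨χ, hχ, hχ0⟩ := aux_integral q hq (MvPolynomial.map ι G)
  set w := Polynomial.Bivariate.swap χ with hw
  have hw0 : w ≠ 0 := by
    rw [hw]
    simpa using hχ.ne_zero
  refine ⟨w.leadingCoeff, by simpa using hw0, fun R hR y hy hmin => ?_⟩
  -- minimizers of the perturbed functions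
  let S : MvPolynomial (Fin n) ℝ := ∑ i, MvPolynomial.C ((D : ℝ)⁻¹) * MvPolynomial.X i ^ D
  have hDpos : (D : ℝ) ≠ 0 := by
    have : D ≠ 0 := by omega
    exact_mod_cast this
  have hS : ∀ i, MvPolynomial.pderiv i S = MvPolynomial.X i ^ (D - 1) := by
    intro i
    simp only [S, map_sum]
    rw [Finset.sum_eq_single i]
    · rw [MvPolynomial.pderiv_C_mul, Derivation.leibniz_pow, MvPolynomial.pderiv_X_self]
      simp only [smul_eq_mul, mul_one, nsmul_eq_mul]
      rw [← mul_assoc, ← map_natCast (MvPolynomial.C (σ := Fin n) (R := ℝ)), ← map_mul,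
        inv_mul_cancel₀ hDpos, map_one, one_mul]
    · intro j _ hj
      rw [MvPolynomial.pderiv_C_mul, Derivation.leibniz_pow, MvPolynomial.pderiv_X_of_ne hj]
      simp
    · simp
  have hex := fun e : ℝ => aux_min (MvPolynomial.C e * G + S) R hR
  choose x hx hxmin using hex
  obtain ⟨z0, hz0, hz0min⟩ := aux_min S R hR
  set c : ℝ := MvPolynomial.eval y S - MvPolynomial.eval z0 S with hc
  have hlim : Filter.Tendsto (fun e => MvPolynomial.eval (x e) G) Filter.atTop
      (nhds (MvPolynomial.eval y G)) := by
    have hu : Filter.Tendsto (fun e : ℝ => MvPolynomial.eval y G + c * e⁻¹) Filter.atTop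
        (nhds (MvPolynomial.eval y G)) := by
      simpa using tendsto_const_nhds.add (tendsto_inv_atTop_zero.const_mul c)
    refine tendsto_of_tendsto_of_tendsto_of_le_of_le' tendsto_const_nhds hu ?_ ?_
    · exact Filter.Eventually.of_forall fun e => hmin _ (hx e)
    · filter_upwards [Filter.eventually_gt_atTop 0] with e he
      have h1 := hxmin e y hy
      simp only [map_add, map_mul, MvPolynomial.eval_C] at h1
      have h2 := hz0min _ (hx e)
      have h3 : e * (MvPolynomial.eval (x e) G - MvPolynomial.eval y G) ≤ c := by
        rw [hc]; nlinarith
      have h4 : MvPolynomial.eval (x e) G - MvPolynomial.eval y G ≤ c * e⁻¹ := by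
        rw [← div_eq_mul_inv, le_div_iff₀ he]; linarith
      linarith
  have key : ∀ e > 0, (w.map (Polynomial.mapRingHom (Polynomial.evalRingHom R))).eval₂
      (Polynomial.evalRingHom (MvPolynomial.eval (x e) G)) e = 0 := by
    intro e _
    let ε : Polynomial (Polynomial ℝ) →+* ℝ := Polynomial.eval₂RingHom (Polynomial.evalRingHom R) e
    have hει : ε.comp ι = RingHom.id ℝ := by ext r; simp [ε, ι]
    have hmap : ∀ Q : MvPolynomial (Fin n) ℝ,
        MvPolynomial.eval₂ ε (x e) (MvPolynomial.map ι Q) = MvPolynomial.eval (x e) Q := by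
      intro Q
      rw [MvPolynomial.eval₂_map, hει]
      rfl
    have hερ : ε ρ = R := by simp [ε, ρ]
    have hεE : ε E = e := by simp [ε, E]
    have h1 := hχ0 ε (x e) (by
      intro i
      have hcr := aux_crit _ R (x e) (hx e) (hxmin e) i
      rw [map_add, MvPolynomial.pderiv_C_mul, hS] at hcr
      simp only [map_add, map_mul, map_pow, MvPolynomial.eval_C, MvPolynomial.eval_X] at hcr
      simp only [q, MvPolynomial.eval₂_sub, MvPolynomial.eval₂_mul, MvPolynomial.eval₂_pow,
        MvPolynomial.eval₂_C, MvPolynomial.eval₂_X, hmap, map_pow, hερ, hεE]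
      have hp : x e i ^ (D + 1) = x e i ^ 2 * x e i ^ (D - 1) := by
        rw [← pow_add]; congr 1; omega
      rw [hp]
      linear_combination hcr)
    rw [hmap] at h1
    rw [← aux_swap, ← hw] at h1
    rw [Polynomial.eval₂_map]
    convert h1 using 2
    ext <;> simp
  have hfin := aux_limit _ w.natDegree Polynomial.natDegree_map_le _ _ hlim key
  rw [Polynomial.coeff_map, Polynomial.coeff_natDegree] at hfin
  rw [Polynomial.coe_mapRingHom, Polynomial.eval_map] at hfin
  exact hfin

theorem aux_poly_bound (p : Polynomial ℝ) :
    ∃ C : ℝ, 0 ≤ C ∧ ∀ K, p.natDegree ≤ K → ∀ R : ℝ, 1 ≤ R → |p.eval R| ≤ C * R ^ K := by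
  refine ⟨∑ i ∈ Finset.range (p.natDegree + 1), |p.coeff i|, by positivity, fun K hK R hR => ?_⟩
  rw [Polynomial.eval_eq_sum_range, Finset.sum_mul]
  refine (Finset.abs_sum_le_sum_abs _ _).trans (Finset.sum_le_sum fun i hi => ?_)
  rw [abs_mul, abs_of_nonneg (by positivity : (0:ℝ) ≤ R ^ i)]
  have hi' := Finset.mem_range.1 hi
  exact mul_le_mul_of_nonneg_left (pow_le_pow_right₀ hR (by omega)) (abs_nonneg _)

theorem aux_poly_lower (p : Polynomial ℝ) (hp : p ≠ 0) :
    ∃ c : ℝ, 0 < c ∧ ∃ R0 : ℝ, ∀ R, R0 ≤ R → c ≤ |p.eval R| := by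
  by_cases hd : 0 < p.degree
  · have := (Polynomial.abs_tendsto_atTop p hd).eventually_ge_atTop 1
    obtain ⟨R0, h⟩ := Filter.eventually_atTop.1 this
    exact ⟨1, one_pos, R0, h⟩
  · rw [Polynomial.eq_C_of_degree_le_zero (not_lt.1 hd)] at hp ⊢
    refine ⟨|p.coeff 0|, ?_, 0, by simp⟩
    simpa using hp

/-- a positive polynomial is bounded below by the inverse of a polynomial -/
theorem aux_lower_bound {n : ℕ} (G : MvPolynomial (Fin n) ℝ)
    (hG : ∀ x, 0 < MvPolynomial.eval x G) :
    ∃ s : MvPolynomial (Fin n) ℝ, ∀ x, 1 ≤ MvPolynomial.eval x s * MvPolynomial.eval x G := by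
  obtain ⟨F, hF, hrel⟩ := aux_relation G
  obtain ⟨F', hF', hndvd⟩ := Polynomial.exists_eq_pow_rootMultiplicity_mul_and_not_dvd F hF 0
  rw [map_zero, sub_zero] at hF' hndvd
  have hc0 : F'.coeff 0 ≠ 0 := fun h => hndvd (Polynomial.X_dvd_iff.2 h)
  obtain ⟨c, hc, R0, hR0⟩ := aux_poly_lower _ hc0
  choose C hC hCb using fun j => aux_poly_bound (F'.coeff j)
  set N := F'.natDegree
  set K := ∑ j ∈ Finset.range (N + 1), (F'.coeff j).natDegree
  set M := 1 + ∑ j ∈ Finset.range (N + 1), C j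
  have hM : 0 < M := by
    have : 0 ≤ ∑ j ∈ Finset.range (N + 1), C j := Finset.sum_nonneg fun j _ => hC j
    linarith
  set L := 1 + M / c
  have hL : 1 ≤ L := by have : 0 < M / c := by positivity
                        linarith
  refine ⟨MvPolynomial.C L * (MvPolynomial.C (|R0| + 1) + ∑ i, MvPolynomial.X i ^ 2) ^ K,
    fun x => ?_⟩
  set R : ℝ := |R0| + 1 + ∑ i, x i ^ 2 with hR
  have hsum : 0 ≤ ∑ i, x i ^ 2 := Finset.sum_nonneg fun i _ => sq_nonneg _
  have hR1 : 1 ≤ R := by have := abs_nonneg R0; linarith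
  have hRR0 : R0 ≤ R := by have := le_abs_self R0; linarith
  have hxR : ∀ i, |x i| ≤ R := fun i => by
    have h1 := Finset.single_le_sum (f := fun i => x i ^ 2) (fun _ _ => sq_nonneg _)
      (Finset.mem_univ i)
    have h2 : |x i| ≤ 1 + x i ^ 2 := by
      rw [← sq_abs (x i)]; nlinarith [sq_nonneg (|x i| - 1), abs_nonneg (x i)]
    have := abs_nonneg R0
    linarith
  have hev : MvPolynomial.eval x (MvPolynomial.C L * (MvPolynomial.C (|R0| + 1) +
      ∑ i, MvPolynomial.X i ^ 2) ^ K) = L * R ^ K := by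
    simp [hR]
  rw [hev]
  obtain ⟨y, hy, hymin⟩ := aux_min G R (by linarith)
  have hr := hrel R (by linarith) y hy hymin
  set m := MvPolynomial.eval y G
  have hm : 0 < m := hG y
  have hRK : 1 ≤ R ^ K := one_le_pow₀ hR1
  suffices h : 1 ≤ L * R ^ K * m from
    h.trans (mul_le_mul_of_nonneg_left (hymin x hxR) (by positivity))
  by_cases hm1 : 1 ≤ m
  · calc (1:ℝ) = 1 * 1 * 1 := by ring
      _ ≤ L * R ^ K * m := by gcongr
  push Not at hm1
  rw [hF', Polynomial.eval₂_mul, Polynomial.eval₂_pow, Polynomial.eval₂_X, mul_eq_zero] at hr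
  have hr' := hr.resolve_left (by positivity)
  rw [Polynomial.eval₂_eq_sum_range, Finset.sum_range_succ'] at hr'
  simp only [Polynomial.coe_evalRingHom, pow_zero, mul_one] at hr'
  have hb : |(F'.coeff 0).eval R| ≤ m * (M * R ^ K) := by
    have e1 : (F'.coeff 0).eval R =
        -∑ j ∈ Finset.range N, (F'.coeff (j + 1)).eval R * m ^ (j + 1) := by linarith
    rw [e1, abs_neg]
    refine (Finset.abs_sum_le_sum_abs _ _).trans ?_
    calc ∑ j ∈ Finset.range N, |(F'.coeff (j + 1)).eval R * m ^ (j + 1)|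
        ≤ ∑ j ∈ Finset.range N, C (j + 1) * R ^ K * m := by
          refine Finset.sum_le_sum fun j hj => ?_
          rw [abs_mul, abs_of_nonneg (by positivity : 0 ≤ m ^ (j + 1))]
          have hjK : (F'.coeff (j + 1)).natDegree ≤ K :=
            Finset.single_le_sum (f := fun j => (F'.coeff j).natDegree)
              (fun _ _ => Nat.zero_le _)
              (Finset.mem_range.2 (by have := Finset.mem_range.1 hj; omega))
          refine mul_le_mul (hCb _ K hjK R hR1) ?_ (by positivity)
            (mul_nonneg (hC _) (by positivity))
          rw [pow_succ]
          exact mul_le_of_le_one_left hm.le (pow_le_one₀ hm.le hm1.le)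
      _ = m * ((∑ j ∈ Finset.range N, C (j + 1)) * R ^ K) := by
          rw [Finset.sum_mul, Finset.mul_sum]
          exact Finset.sum_congr rfl fun _ _ => by ring
      _ ≤ m * (M * R ^ K) := by
          have : ∑ j ∈ Finset.range N, C (j + 1) ≤ M := by
            have := Finset.sum_range_succ' C N
            have := hC 0
            simp only [M]
            linarith
          gcongr
  have hcm : c ≤ m * (M * R ^ K) := (hR0 R hRR0).trans hb
  have h1 : 1 ≤ M / c * R ^ K * m := by
    rw [div_mul_eq_mul_div, div_mul_eq_mul_div, le_div_iff₀ hc]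
    linarith
  have : 0 ≤ R ^ K * m := by positivity
  calc 1 ≤ M / c * R ^ K * m := h1
    _ ≤ L * R ^ K * m := by simp only [L]; nlinarith

/-- a positive element of an affine algebra is bounded below by the inverse of an element -/
theorem aux_inv_bound (B : Type*) [CommRing B] [Algebra ℝ B] [Algebra.FiniteType ℝ B] (f : B)
    (hf : ∀ φ : B →ₐ[ℝ] ℝ, 0 < φ f) :
    ∃ s : B, ∀ φ : B →ₐ[ℝ] ℝ, 1 ≤ φ s * φ f := by
  obtain ⟨n, π, hπ⟩ := Algebra.FiniteType.iff_quotient_mvPolynomial''.1 ‹Algebra.FiniteType ℝ B›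
  obtain ⟨f0, rfl⟩ := hπ f
  obtain ⟨T, hT⟩ := (isNoetherian_def.1 (inferInstance :
    IsNoetherianRing (MvPolynomial (Fin n) ℝ))) (RingHom.ker π)
  obtain ⟨s, hs⟩ := aux_lower_bound (f0 ^ 2 + ∑ g ∈ T, g ^ 2) (fun x => by
    have hnn : ∀ g ∈ T, 0 ≤ MvPolynomial.eval x g ^ 2 := fun _ _ => sq_nonneg _
    simp only [map_add, map_pow, map_sum]
    by_cases h : ∀ g ∈ T, MvPolynomial.eval x g = 0
    · have hk : ∀ g ∈ RingHom.ker π, MvPolynomial.aeval (R := ℝ) x g = 0 := by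
        intro g hg
        have hle : RingHom.ker π ≤ RingHom.ker (MvPolynomial.aeval (R := ℝ) x) := by
          rw [← hT]
          refine Ideal.span_le.2 fun g hg => ?_
          have := h g hg
          simpa [RingHom.mem_ker, MvPolynomial.aeval_eq_eval] using this
        exact hle hg
      let φ : B →ₐ[ℝ] ℝ := (Ideal.Quotient.liftₐ (RingHom.ker π) (MvPolynomial.aeval (R := ℝ) x) hk).comp
        (Ideal.quotientKerAlgEquivOfSurjective hπ).symm.toAlgHom
      have hφ : φ (π f0) = MvPolynomial.eval x f0 := by
        have : (Ideal.quotientKerAlgEquivOfSurjective hπ).symm (π f0) =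
            Ideal.Quotient.mk _ f0 := by
          rw [AlgEquiv.symm_apply_eq]; rfl
        change (Ideal.Quotient.liftₐ (RingHom.ker π) (MvPolynomial.aeval (R := ℝ) x) hk)
          ((Ideal.quotientKerAlgEquivOfSurjective hπ).symm (π f0)) = _
        rw [this]
        rfl
      have := hf φ
      rw [hφ] at this
      have h2 := Finset.sum_nonneg hnn
      positivity
    · push Not at h
      obtain ⟨g, hg, hg0⟩ := h
      have := Finset.sum_pos' hnn ⟨g, hg, by positivity⟩
      positivity)
  refine ⟨π s * π f0, fun φ => ?_⟩
  have hφ : ∀ g, φ (π g) = MvPolynomial.eval (fun i => φ (π (MvPolynomial.X i))) g := by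
    intro g
    rw [← MvPolynomial.coe_aeval_eq_eval]
    have : φ.comp π = MvPolynomial.aeval (fun i => φ (π (MvPolynomial.X i))) := by
      ext i; simp
    exact congrArg (fun u => u g) this
  have h1 := hs fun i => φ (π (MvPolynomial.X i))
  rw [← hφ, ← hφ, map_add, map_sum, map_add, map_sum, Finset.sum_eq_zero, map_pow, map_pow] at h1
  · rw [map_mul]; linarith
  · intro g hg
    have : π g = 0 := by
      have : g ∈ RingHom.ker π := by rw [← hT]; exact Ideal.subset_span hg
      exact this
    simp [this]

theorem aux_real (F σ a0 c0 α γ P e : ℝ) (k n : ℕ) (hF : 0 < F) (hσ : 1 ≤ σ * F)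
    (hα : α * F ^ k = a0) (hγ : γ * F ^ n = c0) (hP : γ * α + P = 1) :
    0 < (1 - e) ^ 2 * ((1 + a0 * (σ ^ (k + 1 + n) * (1 + c0 ^ 2)) * F) * α +
      4 * (1 + α ^ 2) * P ^ 2) + e ^ 2 := by
  have hσ0 : 0 < σ := by
    by_contra h
    push Not at h
    nlinarith
  set Q := F ^ (k + 1) * (σ ^ (k + 1 + n) * (1 + c0 ^ 2)) with hQ
  have hQγ : 2 * |γ| ≤ Q := by
    have e1 : Q = (σ * F) ^ (k + 1) * (σ ^ n * (1 + c0 ^ 2)) := by rw [hQ, mul_pow, pow_add]; ring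
    have h1 : 1 ≤ (σ * F) ^ (k + 1) := one_le_pow₀ hσ
    have h2 : 1 ≤ (σ * F) ^ n := one_le_pow₀ hσ
    have h3 : 2 * |c0| ≤ 1 + c0 ^ 2 := by
      rw [← sq_abs c0]; nlinarith [sq_nonneg (|c0| - 1)]
    calc 2 * |γ| ≤ 2 * |γ| * (σ * F) ^ n := le_mul_of_one_le_right (by positivity) h2
      _ = σ ^ n * (2 * |c0|) := by
          rw [← hγ, abs_mul, abs_of_pos (pow_pos hF n), mul_pow]; ring
      _ ≤ σ ^ n * (1 + c0 ^ 2) := by gcongr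
      _ ≤ Q := by rw [e1]; exact le_mul_of_one_le_left (by positivity) h1
  have hQ0 : 0 ≤ Q := by positivity
  have e2 : (1 + a0 * (σ ^ (k + 1 + n) * (1 + c0 ^ 2)) * F) * α = α + Q * α ^ 2 := by
    rw [hQ, ← hα, pow_succ]; ring
  have main : 0 < α + Q * α ^ 2 + 4 * (1 + α ^ 2) * P ^ 2 := by
    rcases lt_trichotomy α 0 with h | h | h
    · by_cases h1 : 1 < Q * (-α)
      · have : 0 < α + Q * α ^ 2 := by nlinarith
        positivity
      · push Not at h1
        have h2 : |γ| * (-α) ≤ 1 / 2 := by nlinarith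
        have h3 : γ * α ≤ 1 / 2 := by nlinarith [neg_abs_le γ]
        have h4 : 1 / 2 ≤ P := by linarith
        have h5 : 1 / 4 ≤ P ^ 2 := by nlinarith
        have h6 : 1 + α ^ 2 ≤ 4 * (1 + α ^ 2) * P ^ 2 := by nlinarith [sq_nonneg α]
        have h7 : 0 ≤ Q * α ^ 2 := by positivity
        nlinarith [sq_nonneg (α + 1)]
    · subst h
      have : P = 1 := by linarith
      subst this; norm_num
    · positivity
  rw [e2]
  by_cases he : e = 1
  · subst he; norm_num
  · have : 0 < (1 - e) ^ 2 := by
      have : 1 - e ≠ 0 := sub_ne_zero.2 (Ne.symm he)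
      positivity
    positivity

theorem aux_orderIdeal {R Q : Type*} [CommRing R] [AddCommGroup Q] [Module R Q] (q : Q) (x : R)
    (hx : x ∈ orderIdeal R q) : ∃ ψ : Q →ₗ[R] R, ψ q = x := by
  induction hx using Submodule.span_induction with
  | mem x h => exact h
  | zero => exact ⟨0, rfl⟩
  | add x y _ _ hx hy =>
    obtain ⟨u, rfl⟩ := hx
    obtain ⟨v, rfl⟩ := hy
    exact ⟨u + v, rfl⟩
  | smul c x _ hx =>
    obtain ⟨u, rfl⟩ := hx
    exact ⟨c • u, rfl⟩

theorem aux_auto {R M : Type*} [CommRing R] [AddCommGroup M] [Module R M] (u : R) (hu : IsUnit u)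
    (l : M →ₗ[R] R) : ∃ Δ : (R × M) ≃ₗ[R] (R × M), ∀ x y, Δ (x, y) = (u * x + l y, y) := by
  obtain ⟨u, rfl⟩ := hu
  refine ⟨LinearEquiv.ofLinearMap
    (((u : R) • LinearMap.fst R R M + l ∘ₗ LinearMap.snd R R M).prod (LinearMap.snd R R M))
    (((↑u⁻¹ : R) • (LinearMap.fst R R M - l ∘ₗ LinearMap.snd R R M)).prod (LinearMap.snd R R M))
    ?_ ?_, fun x y => ?_⟩
  · refine LinearMap.ext fun z => ?_
    simp [← mul_assoc]
  · refine LinearMap.ext fun z => ?_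
    simp [mul_sub, mul_add, ← mul_assoc]
  · rfl

/-- Let `B` be an affine algebra over `ℝ`, `I` an ideal of `B`, `f ∈ B` with `f > 0` on `X(ℝ)`
(real points being identified with `ℝ`-algebra homomorphisms into `ℝ`), `P` a finitely
generated projective `B_f`-module and `(a, p) ∈ Um(B_f ⊕ P)` with `a ≡ 1 (mod I·B_f)` and
`O(p) + I·B_f = B_f`.  Then there are `h ∈ 1 + Bf` and an automorphism `Δ` of
`B_{fh} ⊕ P_{fh}` with `(a, p)Δ = (a', p)`, where `a' > 0` on `X(ℝ) ∩ Spec B_{fh}` and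
`a' ≡ 1 (mod I·B_{fh})`.  (Here `B_{fh}` is realized as the localization of `B_f` away from
the image `h'` of `h`, and `P_{fh} = P ⊗ B_{fh}` as the localization of `P` at the powers
of `h'`.) -/
theorem make_first_coordinate_positive
    (B : Type*) [CommRing B] [Algebra ℝ B] [Algebra.FiniteType ℝ B]
    (I : Ideal B) (f : B) (hf : ∀ φ : B →ₐ[ℝ] ℝ, 0 < φ f)
    (P : Type*) [AddCommGroup P] [Module (Localization.Away f) P]
    [Module.Finite (Localization.Away f) P] [Module.Projective (Localization.Away f) P]
    (a : Localization.Away f) (p : P)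
    (hum : IsUnimodular (Localization.Away f) ((a, p) : Localization.Away f × P))
    (ha : a - 1 ∈ I.map (algebraMap B (Localization.Away f)))
    (hp : orderIdeal (Localization.Away f) p ⊔ I.map (algebraMap B (Localization.Away f)) = ⊤) :
    ∃ h : B, (∃ b : B, h = 1 + b * f) ∧
      ∃ (Δ : (Localization (Submonoid.powers (algebraMap B (Localization.Away f) h)) × LocalizedModule (Submonoid.powers (algebraMap B (Localization.Away f) h)) P) ≃ₗ[Localization (Submonoid.powers (algebraMap B (Localization.Away f) h))] (Localization (Submonoid.powers (algebraMap B (Localization.Away f) h)) × LocalizedModule (Submonoid.powers (algebraMap B (Localization.Away f) h)) P)) (a' : Localization (Submonoid.powers (algebraMap B (Localization.Away f) h))),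
        Δ (algebraMap (Localization.Away f) (Localization (Submonoid.powers (algebraMap B (Localization.Away f) h))) a,
            LocalizedModule.mkLinearMap (Submonoid.powers (algebraMap B (Localization.Away f) h)) P p) =
          (a', LocalizedModule.mkLinearMap (Submonoid.powers (algebraMap B (Localization.Away f) h)) P p) ∧
        (∀ ψ : (Localization (Submonoid.powers (algebraMap B (Localization.Away f) h))) →ₐ[ℝ] ℝ, 0 < ψ a') ∧
        a' - 1 ∈ I.map (algebraMap B (Localization (Submonoid.powers (algebraMap B (Localization.Away f) h)))) := by
  obtain ⟨σ, hσ⟩ := aux_inv_bound B f hf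
  obtain ⟨Ψ, hΨ⟩ := hum
  set c := Ψ (1, 0) with hc
  set ψ : P →ₗ[Localization.Away f] Localization.Away f := Ψ ∘ₗ LinearMap.inr _ _ _ with hψ
  have hcψ : c * a + ψ p = 1 := by
    rw [← hΨ, hc, mul_comm, ← smul_eq_mul, ← map_smul, hψ, LinearMap.comp_apply, ← map_add]
    simp
  obtain ⟨e, he, i, hi, hei⟩ := Submodule.mem_sup.1
    (show (1 : Localization.Away f) ∈ orderIdeal (Localization.Away f) p ⊔
      I.map (algebraMap B (Localization.Away f)) by rw [hp]; trivial)
  obtain ⟨φ, hφ⟩ := aux_orderIdeal p e he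
  obtain ⟨k, a0, ha0⟩ := IsLocalization.Away.surj f a
  obtain ⟨n, c0, hc0⟩ := IsLocalization.Away.surj f c
  set h : B := 1 + (a0 * (σ ^ (k + 1 + n) * (1 + c0 ^ 2))) * f with hh
  refine ⟨h, ⟨_, rfl⟩, ?_⟩
  set η : (Localization.Away f) := algebraMap B (Localization.Away f) h with hη
  set T := Submonoid.powers η with hT
  set l : P →ₗ[(Localization.Away f)] (Localization.Away f) := (η * a * (e - 2) + e) • φ + (4 * (1 + a ^ 2) * (1 - e) ^ 2 * ψ p) • ψ with hl
  set a' : (Localization.Away f) := (1 - e) ^ 2 * (η * a + 4 * (1 + a ^ 2) * (ψ p) ^ 2) + e ^ 2 with ha'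
  have hlp : η * a + l p = a' := by
    simp only [hl, LinearMap.add_apply, LinearMap.smul_apply, smul_eq_mul, hφ, ha']
    ring
  have hu : IsUnit (algebraMap (Localization.Away f) (Localization T) η) :=
    IsLocalization.map_units (Localization T) (⟨η, Submonoid.mem_powers η⟩ : T)
  let l' : LocalizedModule T P →ₗ[Localization T] Localization T :=
    IsLocalizedModule.mapExtendScalars T (LocalizedModule.mkLinearMap T P)
      (Algebra.linearMap (Localization.Away f) (Localization T)) (Localization T) l
  have hl' : l' (LocalizedModule.mkLinearMap T P p) = algebraMap (Localization.Away f) (Localization T) (l p) := by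
    exact IsLocalizedModule.map_apply T (LocalizedModule.mkLinearMap T P)
      (Algebra.linearMap (Localization.Away f) (Localization T)) l p
  obtain ⟨Δ, hΔ⟩ := aux_auto _ hu l'
  refine ⟨Δ, algebraMap (Localization.Away f) (Localization T) a', ?_, ?_, ?_⟩
  · rw [hΔ, hl', ← map_mul, ← map_add, hlp]
  · intro ω
    let θ : (Localization.Away f) →ₐ[ℝ] ℝ := ω.comp (IsScalarTower.toAlgHom ℝ (Localization.Away f) (Localization T))
    let β : B →ₐ[ℝ] ℝ := θ.comp (IsScalarTower.toAlgHom ℝ B (Localization.Away f))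
    have hβ : ∀ b, θ (algebraMap B (Localization.Away f) b) = β b := fun _ => rfl
    change 0 < θ a'
    have := aux_real (β f) (β σ) (β a0) (β c0) (θ a) (θ c) (θ (ψ p)) (θ e) k n (hf β) (hσ β)
      (by rw [← hβ, ← hβ, ← ha0]; simp) (by rw [← hβ, ← hβ, ← hc0]; simp)
      (by rw [← map_mul, ← map_add, hcψ, map_one])
    rw [ha', hη, hh]
    have h4 : θ 4 = 4 := map_ofNat θ 4
    simpa [hβ, h4] using this
  · have h1 : a' - 1 ∈ I.map (algebraMap B (Localization.Away f)) := by
      have : a' - 1 = i * (i * (η * a + 4 * (1 + a ^ 2) * (ψ p) ^ 2) - (1 + e)) := by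
        rw [ha', show e = 1 - i from eq_sub_of_add_eq hei]
        ring
      rw [this]
      exact Ideal.mul_mem_right _ _ hi
    have h2 := Ideal.mem_map_of_mem (algebraMap (Localization.Away f) (Localization T)) h1
    rw [Ideal.map_map, ← IsScalarTower.algebraMap_eq, map_sub, map_one] at h2
    exact h2
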